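/- Let n ≥ 3 be an integer and let r be a real number with n-2 ≤ r < n-1. Then the quotient space of M_{n,r} by the involution σ (coordinatewise reflection across the x-axis) is homeomorphic to real projective space ℝP^{n-3}, the projectivization of ℝ^{n-2} (equivalently, the quotient of the unit sphere S^{n-3} ⊂ ℝ^{n-2} by the antipodal map). -/

import Mathlib

/-- The point `(a, b)` in the Euclidean plane. -/
noncomputable def planePt (a b : ℝ) : EuclideanSpace ℝ (Fin 2) :=
  WithLp.toLp 2 (fun j => if j = 0 then a else b)

/-- Reflection across the x-axis: `(a, b) ↦ (a, -b)`. -/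
noncomputable def reflX (v : EuclideanSpace ℝ (Fin 2)) : EuclideanSpace ℝ (Fin 2) :=
  planePt (v 0) (-(v 1))

/-- The vertices of the polygon: `x₀ = (0,0)`, `x_{n-1} = (r,0)`, and the variable
vertices `x₁, …, x_{n-2}` given by the tuple `x`. -/
noncomputable def polyVert (n : ℕ) (r : ℝ) (x : Fin (n - 2) → EuclideanSpace ℝ (Fin 2))
    (i : ℕ) : EuclideanSpace ℝ (Fin 2) :=
  if i = 0 then 0
  else if i = n - 1 then planePt r 0
  else if h : i - 1 < n - 2 then x ⟨i - 1, h⟩ else 0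

/-- The moduli space `M_{n,r}` of planar `n`-gons with one side of length `r` and the
other `n-1` sides of length `1`, as a subset of `(ℝ²)^{n-2}`. -/
def MSet (n : ℕ) (r : ℝ) : Set (Fin (n - 2) → EuclideanSpace ℝ (Fin 2)) :=
  { x | ∀ i : ℕ, 1 ≤ i → i ≤ n - 1 →
      dist (polyVert n r x (i - 1)) (polyVert n r x i) = 1 }

section PolygonAux

open Finset

/-- The heights of the vertices, extended by zero at the two endpoints. -/
noncomputable def extY {k : ℕ} (y : Fin k → ℝ) (i : ℕ) : ℝ :=
  if i = 0 then 0 else if h : i - 1 < k then y ⟨i - 1, h⟩ else 0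

/-- The vertical increments. -/
noncomputable def difY {k : ℕ} (y : Fin k → ℝ) (i : ℕ) : ℝ := extY y (i + 1) - extY y i

theorem difY_smul {k : ℕ} (t : ℝ) (y : Fin k → ℝ) (i : ℕ) :
    difY (fun j => t * y j) i = t * difY y i := by
  have h : ∀ i, extY (fun j => t * y j) i = t * extY y i := by
    intro i
    unfold extY
    split_ifs <;> simp
  simp only [difY, h]; ring

theorem extY_succ {k : ℕ} (y : Fin k → ℝ) (j : Fin k) : extY y (j + 1) = y j := by
  simp [extY]

theorem exists_difY_ne {k : ℕ} (y : Fin k → ℝ) (hy : y ≠ 0) :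
    ∃ i ∈ range (k + 1), difY y i ≠ 0 := by
  by_contra! hcon
  apply hy
  have h : ∀ i, i ≤ k + 1 → extY y i = 0 := by
    intro i
    induction i with
    | zero => intro _; simp [extY]
    | succ i ih =>
      intro hi
      have h1 := hcon i (by simp; omega)
      have h2 := ih (by omega)
      unfold difY at h1
      linarith
  funext j
  rw [← extY_succ y j, h _ (by omega)]; rfl

theorem pv_zero (k : ℕ) (r : ℝ) (x) : polyVert (k + 2) r x 0 = 0 := by simp [polyVert]

theorem pv_last (k : ℕ) (r : ℝ) (x) : polyVert (k + 2) r x (k + 1) = planePt r 0 := by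
  simp [polyVert]

theorem pv_mid (k : ℕ) (r : ℝ) (x : Fin (k + 2 - 2) → EuclideanSpace ℝ (Fin 2)) (j : Fin k) :
    polyVert (k + 2) r x (j + 1) = x j := by
  have h1 := j.2
  have h2 : (j : ℕ) ≠ k := by omega
  simp [polyVert, h2]

theorem pv_one (k : ℕ) (r : ℝ) (x : Fin (k + 2 - 2) → EuclideanSpace ℝ (Fin 2)) (i : ℕ) :
    polyVert (k + 2) r x i 1 = extY (k := k) (fun j => x j 1) i := by
  unfold polyVert extY
  by_cases h0 : i = 0
  · simp [h0]
  by_cases h1 : i = k + 1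
  · simp [h1, planePt]
  · have h1' : ¬ (i = k + 2 - 1) := by omega
    rw [if_neg h0, if_neg h0, if_neg h1']
    by_cases h2 : i - 1 < k
    · have h3 : i - 1 < k + 2 - 2 := h2
      rw [dif_pos h2, dif_pos h3]
    · have h3 : ¬ i - 1 < k + 2 - 2 := h2
      rw [dif_neg h2, dif_neg h3]; rfl

theorem dist_one_iff (u v : EuclideanSpace ℝ (Fin 2)) :
    dist u v = 1 ↔ (v 0 - u 0) ^ 2 + (v 1 - u 1) ^ 2 = 1 := by
  rw [EuclideanSpace.dist_eq, Real.sqrt_eq_one]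
  simp only [Fin.sum_univ_two, Real.dist_eq, sq_abs]
  constructor <;> intro h <;> linarith

theorem mem_M_iff (k : ℕ) (r : ℝ) (x : Fin (k + 2 - 2) → EuclideanSpace ℝ (Fin 2)) :
    x ∈ MSet (k + 2) r ↔ ∀ i ∈ range (k + 1),
      (polyVert (k + 2) r x (i + 1) 0 - polyVert (k + 2) r x i 0) ^ 2
        + (difY (k := k) (fun j => x j 1) i) ^ 2 = 1 := by
  unfold MSet difY
  simp only [Set.mem_ofPred_eq, dist_one_iff, pv_one]
  constructor
  · intro h i hi
    have := h (i + 1) (by omega) (by simp at hi; omega)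
    simpa using this
  · intro h i h1 h2
    obtain ⟨i, rfl⟩ : ∃ j, i = j + 1 := ⟨i - 1, by omega⟩
    simpa using h i (by simp; omega)

/-- Each horizontal increment is the nonnegative square root. -/
theorem M_step (k : ℕ) (r : ℝ) (hr : (k : ℝ) ≤ r)
    (x : Fin (k + 2 - 2) → EuclideanSpace ℝ (Fin 2)) (hx : x ∈ MSet (k + 2) r) :
    ∀ i ∈ range (k + 1), polyVert (k + 2) r x (i + 1) 0 - polyVert (k + 2) r x i 0
      = √(1 - (difY (k := k) (fun j => x j 1) i) ^ 2) := by
  rw [mem_M_iff] at hx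
  intro i hi
  set a : ℕ → ℝ := fun i => polyVert (k + 2) r x (i + 1) 0 - polyVert (k + 2) r x i 0 with ha
  have hsum : ∑ i ∈ range (k + 1), a i = r := by
    rw [ha, Finset.sum_range_sub (fun i => polyVert (k + 2) r x i 0), pv_zero, pv_last]
    simp [planePt]
  have hle : ∀ j ∈ range (k + 1), a j ≤ 1 := by
    intro j hj
    have := hx j hj
    have h3 := sq_nonneg (difY (k := k) (fun j => x j 1) j)
    have h4 : (a j) ^ 2 ≤ 1 := by simp only [ha]; linarith
    nlinarith
  have hnn : 0 ≤ a i := by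
    rw [← Finset.add_sum_erase _ _ hi] at hsum
    have h5 : ∑ j ∈ (range (k + 1)).erase i, a j ≤ ∑ j ∈ (range (k + 1)).erase i, (1 : ℝ) :=
      Finset.sum_le_sum fun j hj => hle j (Finset.mem_of_mem_erase hj)
    rw [Finset.sum_const, Finset.card_erase_of_mem hi, card_range] at h5
    simp at h5
    linarith
  have := hx i hi
  change a i = _
  rw [eq_comm, Real.sqrt_eq_iff_mul_self_eq (by nlinarith) hnn]
  simp only [ha]; linarith

theorem M_sum (k : ℕ) (r : ℝ) (hr : (k : ℝ) ≤ r)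
    (x : Fin (k + 2 - 2) → EuclideanSpace ℝ (Fin 2)) (hx : x ∈ MSet (k + 2) r) :
    ∑ i ∈ range (k + 1), √(1 - (difY (k := k) (fun j => x j 1) i) ^ 2) = r := by
  rw [← Finset.sum_congr rfl (M_step k r hr x hx),
    Finset.sum_range_sub (fun i => polyVert (k + 2) r x i 0), pv_zero, pv_last]
  simp [planePt]

theorem M_dif_sq (k : ℕ) (r : ℝ)
    (x : Fin (k + 2 - 2) → EuclideanSpace ℝ (Fin 2)) (hx : x ∈ MSet (k + 2) r) :
    ∀ i ∈ range (k + 1), (difY (k := k) (fun j => x j 1) i) ^ 2 ≤ 1 := by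
  intro i hi
  have := (mem_M_iff k r x).1 hx i hi
  nlinarith [sq_nonneg (polyVert (k + 2) r x (i + 1) 0 - polyVert (k + 2) r x i 0)]

theorem M_y_ne (k : ℕ) (r : ℝ) (hr : (k : ℝ) ≤ r) (hr2 : r < k + 1)
    (x : Fin (k + 2 - 2) → EuclideanSpace ℝ (Fin 2)) (hx : x ∈ MSet (k + 2) r) :
    (fun j : Fin k => x j 1) ≠ 0 := by
  intro h0
  have h := M_sum k r hr x hx
  have h1 : ∀ i, difY (k := k) (fun j => x j 1) i = 0 := by
    intro i
    rw [h0]; simp [difY, extY]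
  simp [h1] at h
  linarith

theorem M_ext (k : ℕ) (r : ℝ) (hr : (k : ℝ) ≤ r)
    (x x' : Fin (k + 2 - 2) → EuclideanSpace ℝ (Fin 2)) (hx : x ∈ MSet (k + 2) r)
    (hx' : x' ∈ MSet (k + 2) r) (h : ∀ j : Fin k, x j 1 = x' j 1) : x = x' := by
  have hf : (fun j : Fin k => x j 1) = (fun j : Fin k => x' j 1) := funext h
  have key : ∀ i, i ≤ k + 1 → polyVert (k + 2) r x i 0 = polyVert (k + 2) r x' i 0 := by
    intro i
    induction i with
    | zero => intro _; rw [pv_zero, pv_zero]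
    | succ i ih =>
      intro hi
      have h1 := M_step k r hr x hx i (by simp; omega)
      have h2 := M_step k r hr x' hx' i (by simp; omega)
      rw [hf] at h1
      have h3 := ih (by omega)
      linarith
  funext j
  ext c
  fin_cases c
  · have := key ((j : Fin k) + 1) (by have := j.2; omega)
    rw [pv_mid k r x j, pv_mid k r x' j] at this
    exact this
  · exact h j

/-- Strict monotonicity along rays. -/
theorem sum_sqrt_lt {k : ℕ} (y : Fin k → ℝ) (hy : y ≠ 0)
    (hd : ∀ i ∈ range (k + 1), (difY y i) ^ 2 ≤ 1) (t : ℝ) (h0 : 0 ≤ t) (h1 : t < 1) :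
    ∑ i ∈ range (k + 1), √(1 - (difY y i) ^ 2)
      < ∑ i ∈ range (k + 1), √(1 - (difY (fun j => t * y j) i) ^ 2) := by
  have ht : t ^ 2 < 1 := by nlinarith
  apply Finset.sum_lt_sum
  · intro i hi
    apply Real.sqrt_le_sqrt
    rw [difY_smul, mul_pow]
    nlinarith [sq_nonneg (difY y i)]
  · obtain ⟨i, hi, hne⟩ := exists_difY_ne y hy
    refine ⟨i, hi, Real.sqrt_lt_sqrt (by linarith [hd i hi]) ?_⟩
    rw [difY_smul, mul_pow]
    have : 0 < (difY y i) ^ 2 := by positivity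
    nlinarith

theorem M_ray (k : ℕ) (r : ℝ) (hr : (k : ℝ) ≤ r) (hr2 : r < k + 1)
    (x x' : Fin (k + 2 - 2) → EuclideanSpace ℝ (Fin 2)) (hx : x ∈ MSet (k + 2) r)
    (hx' : x' ∈ MSet (k + 2) r) (t : ℝ) (ht : 0 ≤ t)
    (h : ∀ j : Fin k, x' j 1 = t * x j 1) : 1 ≤ t := by
  by_contra! hlt
  have := sum_sqrt_lt _ (M_y_ne k r hr hr2 x hx) (M_dif_sq k r x hx) t ht hlt
  have hf : (fun j : Fin k => x' j 1) = (fun j : Fin k => t * x j 1) := funext h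
  have h2 := M_sum k r hr x' hx'
  rw [hf] at h2
  rw [h2, M_sum k r hr x hx] at this
  exact lt_irrefl _ this

theorem M_exists (k : ℕ) (r : ℝ) (y : Fin k → ℝ)
    (hd : ∀ i ∈ range (k + 1), (difY y i) ^ 2 ≤ 1)
    (hs : ∑ i ∈ range (k + 1), √(1 - (difY y i) ^ 2) = r) :
    ∃ x ∈ MSet (k + 2) r, ∀ j : Fin k, x j 1 = y j := by
  let x : Fin (k + 2 - 2) → EuclideanSpace ℝ (Fin 2) := fun j =>
    planePt (∑ i ∈ range ((j : ℕ) + 1), √(1 - (difY y i) ^ 2)) (y j)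
  have hx1 : ∀ j : Fin k, x j 1 = y j := by intro j; simp [x, planePt]
  refine ⟨x, ?_, hx1⟩
  have hp : ∀ i, i ≤ k + 1 →
      polyVert (k + 2) r x i 0 = ∑ i ∈ range i, √(1 - (difY y i) ^ 2) := by
    intro i hi
    rcases Nat.eq_zero_or_pos i with rfl | hpos
    · simp [pv_zero]
    obtain ⟨i, rfl⟩ : ∃ j, i = j + 1 := ⟨i - 1, by omega⟩
    by_cases hik : i = k
    · subst hik
      rw [pv_last, hs]; simp [planePt]
    · have := pv_mid k r x ⟨i, by omega⟩
      simp only at this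
      rw [this]
      simp [x, planePt]
  rw [mem_M_iff]
  intro i hi
  have hi' := Finset.mem_range.1 hi
  have hf : (fun j : Fin k => x j 1) = y := funext hx1
  rw [hp _ (by omega), hp _ (by omega), Finset.sum_range_succ, hf, add_sub_cancel_left,
    Real.sq_sqrt (by linarith [hd i hi])]
  ring

theorem ray_exists (k : ℕ) (r : ℝ) (hr : (k : ℝ) ≤ r) (hr2 : r < k + 1)
    (u : Fin k → ℝ) (hu : u ≠ 0) :
    ∃ t : ℝ, 0 < t ∧ ∃ x ∈ MSet (k + 2) r, ∀ j : Fin k, x j 1 = t * u j := by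
  obtain ⟨i₀, hi₀, hmax⟩ := Finset.exists_max_image (range (k + 1)) (fun i => |difY u i|)
    ⟨0, by simp⟩
  set m := |difY u i₀| with hm
  have hmpos : 0 < m := by
    obtain ⟨i, hi, hne⟩ := exists_difY_ne u hu
    exact lt_of_lt_of_le (abs_pos.2 hne) (hmax i hi)
  let G : ℝ → ℝ := fun t => ∑ i ∈ range (k + 1), √(1 - (t * difY u i) ^ 2)
  have hG : Continuous G := by fun_prop
  have hG0 : G 0 = k + 1 := by simp [G]
  have hG1 : G (1 / m) ≤ k := by
    simp only [G]
    rw [← Finset.add_sum_erase _ _ hi₀]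
    have hz : √(1 - (1 / m * difY u i₀) ^ 2) = 0 := by
      rw [mul_pow, ← sq_abs (difY u i₀), ← hm]
      field_simp
      simp
    have h5 : ∑ j ∈ (range (k + 1)).erase i₀, √(1 - (1 / m * difY u j) ^ 2)
        ≤ ∑ j ∈ (range (k + 1)).erase i₀, (1 : ℝ) :=
      Finset.sum_le_sum fun j hj => by
        rw [Real.sqrt_le_iff]
        refine ⟨zero_le_one, ?_⟩
        linarith [sq_nonneg (1 / m * difY u j)]
    rw [Finset.sum_const, Finset.card_erase_of_mem hi₀, card_range] at h5
    simp only [add_tsub_cancel_right, nsmul_eq_mul, mul_one] at h5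
    linarith
  have h0m : (0 : ℝ) ≤ 1 / m := by positivity
  obtain ⟨t, ⟨ht0, ht1⟩, htr⟩ := intermediate_value_Icc' h0m hG.continuousOn
    (show r ∈ Set.Icc (G (1 / m)) (G 0) from ⟨hG1.trans hr, by linarith⟩)
  have htpos : 0 < t := by
    rcases ht0.eq_or_lt with h | h
    · rw [← h, hG0] at htr; linarith
    · exact h
  refine ⟨t, htpos, M_exists k r (fun j => t * u j) ?_ ?_⟩
  · intro i hi
    rw [difY_smul, ← sq_abs, abs_mul, abs_of_pos htpos]
    have h1 : t * |difY u i| ≤ 1 := by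
      calc t * |difY u i| ≤ 1 / m * m := by
            apply mul_le_mul ht1 (hmax i hi) (abs_nonneg _) h0m
        _ = 1 := by field_simp
    have h2 : 0 ≤ t * |difY u i| := by positivity
    nlinarith
  · simp only [difY_smul]; exact htr

theorem pv_continuous (k : ℕ) (r : ℝ) (i : ℕ) :
    Continuous fun x : Fin (k + 2 - 2) → EuclideanSpace ℝ (Fin 2) => polyVert (k + 2) r x i := by
  unfold polyVert
  split_ifs <;> fun_prop

theorem M_compact (k : ℕ) (r : ℝ) : IsCompact (MSet (k + 2) r) := by
  apply Metric.isCompact_of_isClosed_isBounded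
  · have : MSet (k + 2) r = ⋂ i : ℕ, ⋂ _ : 1 ≤ i, ⋂ _ : i ≤ k + 2 - 1,
        {x | dist (polyVert (k + 2) r x (i - 1)) (polyVert (k + 2) r x i) = 1} := by
      ext x; simp [MSet]
    rw [this]
    refine isClosed_iInter fun i => isClosed_iInter fun _ => isClosed_iInter fun _ => ?_
    exact isClosed_eq ((pv_continuous k r _).dist (pv_continuous k r _)) continuous_const
  · rw [isBounded_iff_forall_norm_le]
    refine ⟨k + 1, fun x hx => ?_⟩
    have key : ∀ i, i ≤ k + 1 → ‖polyVert (k + 2) r x i‖ ≤ i := by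
      intro i
      induction i with
      | zero => intro _; simp [pv_zero]
      | succ i ih =>
        intro hi
        have h1 := hx (i + 1) (by omega) (by omega)
        simp only [add_tsub_cancel_right] at h1
        have h2 := ih (by omega)
        rw [dist_eq_norm, norm_sub_rev] at h1
        have h3 := norm_sub_norm_le (polyVert (k + 2) r x (i + 1)) (polyVert (k + 2) r x i)
        push_cast
        linarith
    rw [pi_norm_le_iff_of_nonneg (by positivity)]
    intro j
    have hj : (j : ℕ) < k := j.2
    have := key ((j : Fin k) + 1) (by omega)
    rw [pv_mid k r x j] at this
    refine this.trans ?_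
    push_cast
    have : ((j : ℕ) : ℝ) ≤ k := by exact_mod_cast hj.le
    linarith

/-- The vector of heights. -/
noncomputable def hts (k : ℕ) (x : Fin k → EuclideanSpace ℝ (Fin 2)) :
    EuclideanSpace ℝ (Fin k) := WithLp.toLp 2 (fun j => x j 1)

theorem hts_continuous (k : ℕ) : Continuous (hts k) := by
  unfold hts
  fun_prop

theorem hts_ne (k : ℕ) (r : ℝ) (hr : (k : ℝ) ≤ r) (hr2 : r < k + 1)
    (x : MSet (k + 2) r) : hts k x.1 ≠ 0 := by
  intro h
  apply M_y_ne k r hr hr2 x.1 x.2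
  funext j
  have := congrArg (fun v => v j) h
  simpa [hts] using this

theorem hts_refl (k : ℕ) (x : Fin k → EuclideanSpace ℝ (Fin 2)) :
    hts k (fun i => reflX (x i)) = - hts k x := by
  ext j
  simp [hts, reflX, planePt]

/-- The normalized height map. -/
noncomputable def phi (k : ℕ) (r : ℝ) (hr : (k : ℝ) ≤ r) (hr2 : r < k + 1)
    (x : MSet (k + 2) r) : Metric.sphere (0 : EuclideanSpace ℝ (Fin k)) 1 :=
  ⟨‖hts k x.1‖⁻¹ • hts k x.1, by
    rw [mem_sphere_zero_iff_norm, norm_smul, norm_inv, norm_norm,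
      inv_mul_cancel₀ (norm_ne_zero_iff.2 (hts_ne k r hr hr2 x))]⟩

theorem phi_continuous (k : ℕ) (r : ℝ) (hr : (k : ℝ) ≤ r) (hr2 : r < k + 1) :
    Continuous (phi k r hr hr2) := by
  have h : Continuous fun x : MSet (k + 2) r => hts k x.1 :=
    (hts_continuous k).comp continuous_subtype_val
  refine Continuous.subtype_mk ?_ _
  exact (h.norm.inv₀ fun x => norm_ne_zero_iff.2 (hts_ne k r hr hr2 x)).smul h

theorem phi_inj (k : ℕ) (r : ℝ) (hr : (k : ℝ) ≤ r) (hr2 : r < k + 1) :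
    Function.Injective (phi k r hr hr2) := by
  intro x x' h
  have ha := norm_pos_iff.2 (hts_ne k r hr hr2 x)
  have hb := norm_pos_iff.2 (hts_ne k r hr hr2 x')
  set a := ‖hts k x.1‖
  set b := ‖hts k x'.1‖
  have hv : ∀ j : Fin k, a⁻¹ * x.1 j 1 = b⁻¹ * x'.1 j 1 := by
    intro j
    have := congrArg (fun v => v.1 j) h
    exact this
  have h1 : 1 ≤ b / a := M_ray k r hr hr2 x.1 x'.1 x.2 x'.2 (b / a) (by positivity) (by
    intro j
    have := hv j
    field_simp at this ⊢
    linarith)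
  have h2 : 1 ≤ a / b := M_ray k r hr hr2 x'.1 x.1 x'.2 x.2 (a / b) (by positivity) (by
    intro j
    have := hv j
    field_simp at this ⊢
    linarith)
  rw [one_le_div ha] at h1
  rw [one_le_div hb] at h2
  have hab : a = b := le_antisymm h1 h2
  apply Subtype.ext
  refine M_ext k r hr _ _ x.2 x'.2 fun j => ?_
  have := hv j
  rw [hab] at this
  exact mul_left_cancel₀ (inv_ne_zero hb.ne') this

theorem phi_surj (k : ℕ) (r : ℝ) (hr : (k : ℝ) ≤ r) (hr2 : r < k + 1) :
    Function.Surjective (phi k r hr hr2) := by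
  intro u
  have hu : ‖u.1‖ = 1 := mem_sphere_zero_iff_norm.1 u.2
  obtain ⟨t, ht, x, hx, hxt⟩ := ray_exists k r hr hr2 (fun j => u.1 j) (by
    intro h
    have : u.1 = 0 := by ext j; exact congrFun h j
    rw [this] at hu
    simp at hu)
  refine ⟨⟨x, hx⟩, Subtype.ext ?_⟩
  have h : hts k x = t • u.1 := by
    ext j
    simpa [hts] using hxt j
  simp only [phi]
  rw [h, norm_smul, hu, Real.norm_of_nonneg ht.le, mul_one, smul_smul, inv_mul_cancel₀ ht.ne',
    one_smul]

theorem phi_rel (k : ℕ) (r : ℝ) (hr : (k : ℝ) ≤ r) (hr2 : r < k + 1) (P Q : MSet (k + 2) r) :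
    (Q.1 = fun i => reflX (P.1 i)) ↔ (phi k r hr hr2 Q).1 = -(phi k r hr hr2 P).1 := by
  have fwd : ∀ P Q : MSet (k + 2) r, (Q.1 = fun i => reflX (P.1 i)) →
      (phi k r hr hr2 Q).1 = -(phi k r hr hr2 P).1 := by
    intro P Q h
    have h' : hts k Q.1 = - hts k P.1 := by rw [h]; exact hts_refl k P.1
    simp only [phi]
    rw [h', norm_neg, smul_neg]
  refine ⟨fwd P Q, fun h => ?_⟩
  have hmem : (fun i => reflX (P.1 i)) ∈ MSet (k + 2) r := by
    have hp : ∀ i, polyVert (k + 2) r (fun i => reflX (P.1 i)) i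
        = reflX (polyVert (k + 2) r P.1 i) := by
      intro i
      unfold polyVert
      have h0 : reflX 0 = 0 := by ext c; fin_cases c <;> simp [reflX, planePt]
      have h1 : reflX (planePt r 0) = planePt r 0 := by
        ext c; fin_cases c <;> simp [reflX, planePt]
      split_ifs <;> simp [h0, h1]
    intro i h1 h2
    have h3 := P.2 i h1 h2
    rw [hp, hp, dist_one_iff]
    rw [dist_one_iff] at h3
    simp only [reflX, planePt]
    simp
    linarith
  have h2 := fwd P ⟨_, hmem⟩ rfl
  have h3 : phi k r hr hr2 Q = phi k r hr hr2 ⟨_, hmem⟩ := Subtype.ext (h.trans h2.symm)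
  exact congrArg Subtype.val (phi_inj k r hr hr2 h3)

/-- A homeomorphism respecting relations descends to the quotients. -/
theorem quot_homeo {X Y : Type*} [TopologicalSpace X] [TopologicalSpace Y] (e : X ≃ₜ Y)
    (R : X → X → Prop) (S : Y → Y → Prop) (h : ∀ a b, R a b ↔ S (e a) (e b)) :
    Nonempty (Quot R ≃ₜ Quot S) :=
  ⟨{ toEquiv := Quot.congr e.toEquiv h
     continuous_toFun := continuous_quot_lift _ (continuous_quot_mk.comp e.continuous)
     continuous_invFun := continuous_quot_lift _ (continuous_quot_mk.comp e.symm.continuous) }⟩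

end PolygonAux

/-- For `n ≥ 3` and `n-2 ≤ r < n-1`, the quotient of `M_{n,r}` by the
involution `σ` (coordinatewise reflection across the x-axis) is homeomorphic to real
projective space `ℝP^{n-3}`, here realized as the quotient of the unit sphere
`S^{n-3} ⊂ ℝ^{n-2}` by the antipodal map. -/
theorem polygon_space_quotient_homeo_realProjective
    (n : ℕ) (hn : 3 ≤ n) (r : ℝ) (hr1 : (n : ℝ) - 2 ≤ r) (hr2 : r < (n : ℝ) - 1) :
    Nonempty
      ((Quot (fun P Q : MSet n r => (Q : Fin (n - 2) → EuclideanSpace ℝ (Fin 2))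
          = fun i => reflX ((P : Fin (n - 2) → EuclideanSpace ℝ (Fin 2)) i))) ≃ₜ
       (Quot (fun x y : Metric.sphere (0 : EuclideanSpace ℝ (Fin (n - 2))) 1 =>
          (y : EuclideanSpace ℝ (Fin (n - 2))) = -(x : EuclideanSpace ℝ (Fin (n - 2)))))) := by
  obtain ⟨k, rfl⟩ : ∃ k, n = k + 2 := ⟨n - 2, by omega⟩
  have hr : (k : ℝ) ≤ r := by push_cast at hr1; linarith
  have hr' : r < k + 1 := by push_cast at hr2; linarith
  have : CompactSpace (MSet (k + 2) r) := isCompact_iff_compactSpace.1 (M_compact k r)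
  let e : MSet (k + 2) r ≃ₜ Metric.sphere (0 : EuclideanSpace ℝ (Fin k)) 1 :=
    Continuous.homeoOfEquivCompactToT2
      (f := Equiv.ofBijective (phi k r hr hr') ⟨phi_inj k r hr hr', phi_surj k r hr hr'⟩)
      (phi_continuous k r hr hr')
  exact quot_homeo e _ _ fun P Q => phi_rel k r hr hr' P Q
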